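/- arXiv:1109.3346 — 3 statements merged into one kernel-verified Lean document; each statement's English description precedes it below -/
import Mathlib

section
/- Let 0 < θ < 1, set ν = 2/(1−θ) and c₀ = ((1−θ)²/2)^{1/(1−θ)}. Define X⁻(t) = −c₀ t^ν and P⁻(t) = −c₀ ν t^{ν−1} for t ≥ 0. Then X⁻ and P⁻ are continuously differentiable on [0,∞), satisfy X⁻(0) = 0 and P⁻(0) = 0, and for every t ≥ 0 one has (X⁻)′(t) = P⁻(t) and (P⁻)′(t) = (1+θ)|X⁻(t)|^θ · sgn(X⁻(t)). -/
/-- The amplitude `c = ((1 - θ)² / 2) ^ (1 / (1 - θ))` balances the two sides of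
`c ν (ν - 1) = (1 + θ) c ^ θ` with `ν = 2 / (1 - θ)`. -/
theorem amplitude_balance {θ : ℝ} (hθ : θ < 1) {c : ℝ}
    (hc : c = ((1 - θ) ^ 2 / 2) ^ (1 / (1 - θ))) :
    c * (2 / (1 - θ)) * (2 / (1 - θ) - 1) = (1 + θ) * c ^ θ := by
  have h1 : 0 < 1 - θ := by linarith
  have hb : 0 < (1 - θ) ^ 2 / 2 := by positivity
  have hc0 : 0 < c := hc ▸ Real.rpow_pos_of_pos hb _
  have hpow : c ^ (1 - θ) = (1 - θ) ^ 2 / 2 := by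
    rw [hc, ← Real.rpow_mul hb.le, one_div_mul_cancel h1.ne', Real.rpow_one]
  have hsplit : c = c ^ θ * ((1 - θ) ^ 2 / 2) := by
    rw [← hpow, ← Real.rpow_add hc0, add_sub_cancel, Real.rpow_one]
  have hcoef : (1 - θ) ^ 2 / 2 * (2 / (1 - θ)) * (2 / (1 - θ) - 1) = 1 + θ := by
    field_simp
    ring
  calc c * (2 / (1 - θ)) * (2 / (1 - θ) - 1)
      = c ^ θ * ((1 - θ) ^ 2 / 2) * (2 / (1 - θ)) * (2 / (1 - θ) - 1) := by rw [← hsplit]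
    _ = c ^ θ * ((1 - θ) ^ 2 / 2 * (2 / (1 - θ)) * (2 / (1 - θ) - 1)) := by ring
    _ = (1 + θ) * c ^ θ := by rw [hcoef, mul_comm]

/-- A function equal to `-(a * t ^ p)` with `1 ≤ p` on the half-line is `C¹` there. -/
theorem contDiffOn_Ici_of_eq_neg_mul_rpow {f : ℝ → ℝ} {a p : ℝ} (hp : 1 ≤ p)
    (hf : ∀ t : ℝ, 0 ≤ t → f t = -(a * t ^ p)) : ContDiffOn ℝ 1 f (Set.Ici 0) := by
  have h : ContDiff ℝ 1 fun t : ℝ => t ^ p := by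
    exact_mod_cast Real.contDiff_rpow_const_of_le (n := 1) (by exact_mod_cast hp)
  exact (contDiff_const.mul h).neg.contDiffOn.congr fun t ht => hf t ht

/-- The one-sided derivative of a function equal to `-(a * t ^ p)` with `1 ≤ p` on the
half-line. -/
theorem hasDerivWithinAt_Ici_of_eq_neg_mul_rpow {f : ℝ → ℝ} {a p : ℝ} (hp : 1 ≤ p)
    (hf : ∀ t : ℝ, 0 ≤ t → f t = -(a * t ^ p)) {t : ℝ} (ht : 0 ≤ t) :
    HasDerivWithinAt f (-(a * (p * t ^ (p - 1)))) (Set.Ici 0) t :=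
  ((Real.hasDerivAt_rpow_const (Or.inr hp)).const_mul a).neg.hasDerivWithinAt.congr
    (fun s hs => hf s hs) (hf t ht)

/- STATEMENT 1: the reflected explicit escaping solution `(X⁻, P⁻)` of the Hamiltonian system
`ẋ = p`, `ṗ = (1+θ)|x|^θ sgn x` (potential `V(x) = -|x|^{1+θ}`) with initial datum `(0,0)`. -/
theorem escaping_solution_minus (θ : ℝ) (hθ0 : 0 < θ) (hθ1 : θ < 1)
    (ν c₀ : ℝ) (hν : ν = 2 / (1 - θ))
    (hc₀ : c₀ = ((1 - θ) ^ 2 / 2) ^ (1 / (1 - θ)))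
    (X P : ℝ → ℝ)
    (hX : ∀ t : ℝ, 0 ≤ t → X t = -(c₀ * t ^ ν))
    (hP : ∀ t : ℝ, 0 ≤ t → P t = -(c₀ * ν * t ^ (ν - 1))) :
    ContDiffOn ℝ 1 X (Set.Ici 0) ∧ ContDiffOn ℝ 1 P (Set.Ici 0) ∧
    X 0 = 0 ∧ P 0 = 0 ∧
    (∀ t : ℝ, 0 ≤ t → HasDerivWithinAt X (P t) (Set.Ici 0) t) ∧
    (∀ t : ℝ, 0 ≤ t →
      HasDerivWithinAt P ((1 + θ) * |X t| ^ θ * Real.sign (X t)) (Set.Ici 0) t) := by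
  have h1 : 0 < 1 - θ := by linarith
  have hν2 : ν - 2 = ν * θ := by
    rw [hν]
    field_simp
    ring
  have hν0 : 0 < ν := hν ▸ by positivity
  have hνθ : 0 < ν * θ := by positivity
  have hc0 : 0 < c₀ := hc₀ ▸ Real.rpow_pos_of_pos (by positivity) _
  have hbal : c₀ * ν * (ν - 1) = (1 + θ) * c₀ ^ θ := hν ▸ amplitude_balance hθ1 hc₀
  have hp1 : 1 ≤ ν := by linarith
  have hp2 : 1 ≤ ν - 1 := by linarith
  refine ⟨contDiffOn_Ici_of_eq_neg_mul_rpow hp1 hX, contDiffOn_Ici_of_eq_neg_mul_rpow hp2 hP,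
    ?_, ?_, fun t ht => ?_, fun t ht => ?_⟩
  · rw [hX 0 le_rfl, Real.zero_rpow hν0.ne', mul_zero, neg_zero]
  · rw [hP 0 le_rfl, Real.zero_rpow (by linarith), mul_zero, neg_zero]
  · rw [hP t ht, mul_assoc]
    exact hasDerivWithinAt_Ici_of_eq_neg_mul_rpow hp1 hX ht
  · convert hasDerivWithinAt_Ici_of_eq_neg_mul_rpow hp2 hP ht using 1
    rw [hX t ht, show ν - 1 - 1 = ν * θ by linarith, ← mul_assoc, hbal]
    rcases ht.eq_or_lt with rfl | ht
    · simp [Real.zero_rpow hν0.ne', Real.zero_rpow hνθ.ne']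
    · have hpos : 0 < c₀ * t ^ ν := mul_pos hc0 (Real.rpow_pos_of_pos ht _)
      rw [Real.sign_of_neg (neg_lt_zero.mpr hpos), abs_neg, abs_of_pos hpos,
        Real.mul_rpow hc0.le (Real.rpow_nonneg ht.le _), ← Real.rpow_mul ht.le]
      ring
end

section
/- Let 0 < θ < 1, set ν = 2/(1−θ) and c₀ = ((1−θ)²/2)^{1/(1−θ)}, and let t₀ ≥ 0. Define x_{t₀}(t) = 0 for 0 ≤ t ≤ t₀ and x_{t₀}(t) = c₀ (t−t₀)^ν for t > t₀, and p_{t₀}(t) = 0 for 0 ≤ t ≤ t₀ and p_{t₀}(t) = c₀ ν (t−t₀)^{ν−1} for t > t₀. Then x_{t₀} and p_{t₀} are continuously differentiable on [0,∞), satisfy (x_{t₀}(0), p_{t₀}(0)) = (0,0), and for every t ≥ 0 one has x_{t₀}′(t) = p_{t₀}(t) and p_{t₀}′(t) = (1+θ)|x_{t₀}(t)|^θ sgn(x_{t₀}(t)). (The analogous statement holds for the reflected family (−x_{t₀}, −p_{t₀}).) -/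
/-- The truncated power `s ↦ (max s 0) ^ a` is differentiable for `1 < a`. -/
theorem hasDerivAt_max_zero_rpow {a : ℝ} (ha : 1 < a) (s : ℝ) :
    HasDerivAt (fun s : ℝ => max s 0 ^ a) (a * max s 0 ^ (a - 1)) s := by
  have ha0 : a ≠ 0 := by linarith
  have ha1 : a - 1 ≠ 0 := by linarith
  rcases lt_trichotomy s 0 with hs | rfl | hs
  · rw [max_eq_right hs.le, Real.zero_rpow ha1, mul_zero]
    refine (hasDerivAt_const s (0 : ℝ)).congr_of_eventuallyEq ?_
    filter_upwards [gt_mem_nhds hs] with u hu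
    rw [max_eq_right hu.le, Real.zero_rpow ha0]
  · rw [← hasDerivWithinAt_univ, ← Set.Iic_union_Ici (a := (0 : ℝ))]
    refine HasDerivWithinAt.union ?_ ?_
    · rw [max_self, Real.zero_rpow ha1, mul_zero]
      refine (hasDerivWithinAt_const (0 : ℝ) _ (0 : ℝ)).congr ?_ (by simp [ha0])
      intro u hu
      rw [max_eq_right hu, Real.zero_rpow ha0]
    · rw [max_self]
      refine (Real.hasDerivAt_rpow_const (Or.inr ha.le)).hasDerivWithinAt.congr ?_ (by simp)
      intro u hu
      rw [max_eq_left hu]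
  · rw [max_eq_left hs.le]
    refine (Real.hasDerivAt_rpow_const (Or.inr ha.le)).congr_of_eventuallyEq ?_
    filter_upwards [lt_mem_nhds hs] with u hu
    rw [max_eq_left hu.le]

/-- The truncated power `s ↦ (max s 0) ^ a` is `C¹` for `1 < a`. -/
theorem contDiff_one_max_zero_rpow {a : ℝ} (ha : 1 < a) :
    ContDiff ℝ 1 (fun s : ℝ => max s 0 ^ a) := by
  rw [contDiff_one_iff_deriv]
  refine ⟨fun s => (hasDerivAt_max_zero_rpow ha s).differentiableAt, ?_⟩
  rw [funext fun s => (hasDerivAt_max_zero_rpow ha s).deriv]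
  exact continuous_const.mul
    ((continuous_id.max continuous_const).rpow_const fun _ => Or.inr (by linarith))

/-- The profile `c s ^ ν` solves `f'' = (1 + θ) |f| ^ θ sgn f` for the escape constant `c`. -/
theorem escape_profile_force {θ ν c : ℝ} (hθ0 : 0 < θ) (hθ1 : θ < 1) (hν : ν = 2 / (1 - θ))
    (hc : c = ((1 - θ) ^ 2 / 2) ^ (1 / (1 - θ))) {s : ℝ} (hs : 0 ≤ s) :
    c * ν * ((ν - 1) * s ^ (ν - 1 - 1)) = (1 + θ) * |c * s ^ ν| ^ θ * Real.sign (c * s ^ ν) := by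
  have h1 : 0 < 1 - θ := by linarith
  have hbase : 0 < (1 - θ) ^ 2 / 2 := by positivity
  have hcpos : 0 < c := hc ▸ Real.rpow_pos_of_pos hbase _
  have hν0 : 0 < ν := hν ▸ by positivity
  have hexp : ν - 1 - 1 = ν * θ := by rw [hν]; field_simp; ring
  rcases hs.eq_or_lt with rfl | hs
  · rw [hexp, Real.zero_rpow hν0.ne', Real.zero_rpow (by positivity)]
    simp
  · have hsν : 0 < s ^ ν := Real.rpow_pos_of_pos hs ν
    have hcθ : c ^ (1 - θ) = (1 - θ) ^ 2 / 2 := by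
      rw [hc, ← Real.rpow_mul hbase.le, one_div_mul_cancel h1.ne', Real.rpow_one]
    have hsplit : c = c ^ θ * ((1 - θ) ^ 2 / 2) := by
      rw [← hcθ, ← Real.rpow_add hcpos, add_sub_cancel, Real.rpow_one]
    have hcoef : c * ν * (ν - 1) = (1 + θ) * c ^ θ := by
      rw [mul_assoc]
      nth_rewrite 1 [hsplit]
      rw [hν]
      field_simp
      ring
    rw [Real.sign_of_pos (mul_pos hcpos hsν), abs_of_pos (mul_pos hcpos hsν),
      Real.mul_rpow hcpos.le hsν.le, ← Real.rpow_mul hs.le, hexp, ← mul_assoc, hcoef]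
    ring


/- STATEMENT 3: for every delay `t₀ ≥ 0`, the trajectory which sits at the equilibrium
`(0,0)` up to time `t₀` and then follows the explicit escaping solution is a `C¹`
solution of `ẋ = p`, `ṗ = (1+θ)|x|^θ sgn x` with initial datum `(0,0)`; the same
holds for the reflected family `(-x_{t₀}, -p_{t₀})`. -/
theorem delayed_solution (θ : ℝ) (hθ0 : 0 < θ) (hθ1 : θ < 1)
    (ν c₀ : ℝ) (hν : ν = 2 / (1 - θ))
    (hc₀ : c₀ = ((1 - θ) ^ 2 / 2) ^ (1 / (1 - θ)))
    (t₀ : ℝ) (ht₀ : 0 ≤ t₀)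
    (x p : ℝ → ℝ)
    (hx0 : ∀ t : ℝ, 0 ≤ t → t ≤ t₀ → x t = 0)
    (hx1 : ∀ t : ℝ, t₀ < t → x t = c₀ * (t - t₀) ^ ν)
    (hp0 : ∀ t : ℝ, 0 ≤ t → t ≤ t₀ → p t = 0)
    (hp1 : ∀ t : ℝ, t₀ < t → p t = c₀ * ν * (t - t₀) ^ (ν - 1)) :
    (ContDiffOn ℝ 1 x (Set.Ici 0) ∧ ContDiffOn ℝ 1 p (Set.Ici 0) ∧
      x 0 = 0 ∧ p 0 = 0 ∧
      (∀ t : ℝ, 0 ≤ t → HasDerivWithinAt x (p t) (Set.Ici 0) t) ∧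
      (∀ t : ℝ, 0 ≤ t →
        HasDerivWithinAt p ((1 + θ) * |x t| ^ θ * Real.sign (x t)) (Set.Ici 0) t)) ∧
    (ContDiffOn ℝ 1 (fun t => -x t) (Set.Ici 0) ∧ ContDiffOn ℝ 1 (fun t => -p t) (Set.Ici 0) ∧
      -x 0 = 0 ∧ -p 0 = 0 ∧
      (∀ t : ℝ, 0 ≤ t → HasDerivWithinAt (fun t => -x t) (-p t) (Set.Ici 0) t) ∧
      (∀ t : ℝ, 0 ≤ t →
        HasDerivWithinAt (fun t => -p t)
          ((1 + θ) * |(-x t)| ^ θ * Real.sign (-x t)) (Set.Ici 0) t)) := by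
  have h1 : 0 < 1 - θ := by linarith
  have hν2 : 2 < ν := by
    rw [hν, lt_div_iff₀ h1]
    linarith
  have hx : ∀ t ∈ Set.Ici (0 : ℝ), x t = c₀ * max (t - t₀) 0 ^ ν := by
    intro t ht
    rcases le_or_gt t t₀ with h | h
    · rw [hx0 t ht h, max_eq_right (by linarith), Real.zero_rpow (by linarith), mul_zero]
    · rw [hx1 t h, max_eq_left (by linarith)]
  have hp : ∀ t ∈ Set.Ici (0 : ℝ), p t = c₀ * ν * max (t - t₀) 0 ^ (ν - 1) := by
    intro t ht
    rcases le_or_gt t t₀ with h | h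
    · rw [hp0 t ht h, max_eq_right (by linarith), Real.zero_rpow (by linarith), mul_zero]
    · rw [hp1 t h, max_eq_left (by linarith)]
  have hsub : ContDiff ℝ 1 (fun t : ℝ => t - t₀) := contDiff_id.sub contDiff_const
  have hxC : ContDiffOn ℝ 1 x (Set.Ici 0) :=
    (contDiff_const.mul ((contDiff_one_max_zero_rpow (by linarith)).comp hsub)).contDiffOn.congr hx
  have hpC : ContDiffOn ℝ 1 p (Set.Ici 0) :=
    (contDiff_const.mul ((contDiff_one_max_zero_rpow (by linarith)).comp hsub)).contDiffOn.congr hp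
  have hxD : ∀ t : ℝ, 0 ≤ t → HasDerivWithinAt x (p t) (Set.Ici 0) t := by
    intro t ht
    rw [hp t ht, mul_assoc]
    exact ((((hasDerivAt_max_zero_rpow (by linarith) (t - t₀)).comp_sub_const t t₀).const_mul
      c₀).hasDerivWithinAt).congr hx (hx t ht)
  have hpD : ∀ t : ℝ, 0 ≤ t →
      HasDerivWithinAt p ((1 + θ) * |x t| ^ θ * Real.sign (x t)) (Set.Ici 0) t := by
    intro t ht
    rw [hx t ht, ← escape_profile_force hθ0 hθ1 hν hc₀ (le_max_right (t - t₀) 0)]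
    exact ((((hasDerivAt_max_zero_rpow (by linarith) (t - t₀)).comp_sub_const t t₀).const_mul
      (c₀ * ν)).hasDerivWithinAt).congr hp (hp t ht)
  have hx00 : x 0 = 0 := hx0 0 le_rfl ht₀
  have hp00 : p 0 = 0 := hp0 0 le_rfl ht₀
  refine ⟨⟨hxC, hpC, hx00, hp00, hxD, hpD⟩, hxC.neg, hpC.neg, by rw [hx00, neg_zero],
    by rw [hp00, neg_zero], fun t ht => (hxD t ht).neg, fun t ht => ?_⟩
  rw [abs_neg, Real.sign_neg, mul_neg]
  exact (hpD t ht).neg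
end

section
/- Let 0 < θ < 1, set ν = 2/(1−θ) and c₀ = ((1−θ)²/2)^{1/(1−θ)}, and let (X^±(t), P^±(t)) = (±c₀ t^ν, ±c₀ ν t^{ν−1}) for t ≥ 0. Let c₊, c₋ ≥ 0 with c₊ + c₋ = 1, and define the family of probability measures on ℝ² by μ_t := c₊ δ_{(X⁺(t), P⁺(t))} + c₋ δ_{(X⁻(t), P⁻(t))}, with μ₀ = δ_{(0,0)}. Then (μ_t)_{t ≥ 0} is a weak (distributional) solution of the Liouville equation ∂_t μ + p ∂_x μ + (1+θ)|x|^θ sgn(x) ∂_p μ = 0: for every compactly supported smooth test function φ : ℝ² → ℝ, the map t ↦ ∫ φ dμ_t is differentiable on [0,∞) and d/dt ∫ φ dμ_t = ∫ ( p ∂_x φ(x,p) + (1+θ)|x|^θ sgn(x) ∂_p φ(x,p) ) dμ_t(x,p) for all t ≥ 0. -/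
open MeasureTheory

theorem integral_two_diracs {α : Type*} [MeasurableSpace α] [MeasurableSingletonClass α]
    (f : α → ℝ) (a b : α) {cp cm : ℝ} (hcp : 0 ≤ cp) (hcm : 0 ≤ cm) :
    ∫ q, f q ∂(ENNReal.ofReal cp • Measure.dirac a + ENNReal.ofReal cm • Measure.dirac b) =
      cp * f a + cm * f b := by
  have hint (c : ℝ) (x : α) : Integrable f (ENNReal.ofReal c • Measure.dirac x) :=
    (integrable_dirac (by simp)).smul_measure ENNReal.ofReal_ne_top
  rw [integral_add_measure (hint cp a) (hint cm b), integral_smul_measure, integral_smul_measure,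
    integral_dirac, integral_dirac, ENNReal.toReal_ofReal hcp, ENNReal.toReal_ofReal hcm,
    smul_eq_mul, smul_eq_mul]

/-- Chain rule along a curve in the plane, in terms of the two partial derivatives. -/
theorem hasDerivWithinAt_comp_prodMk {φ : ℝ × ℝ → ℝ} {x p : ℝ → ℝ} {x' p' t : ℝ} {s : Set ℝ}
    (hφ : DifferentiableAt ℝ φ (x t, p t)) (hx : HasDerivWithinAt x x' s t)
    (hp : HasDerivWithinAt p p' s t) :
    HasDerivWithinAt (fun r => φ (x r, p r))
      (x' * fderiv ℝ φ (x t, p t) (1, 0) + p' * fderiv ℝ φ (x t, p t) (0, 1)) s t := by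
  have h := hφ.hasFDerivAt.comp_hasDerivWithinAt t (hx.prodMk hp)
  have he : ((x', p') : ℝ × ℝ) = x' • (1, 0) + p' • (0, 1) := by simp
  rw [he, map_add, map_smul, map_smul] at h
  exact h

/-- The escaping trajectory `c₀ t ^ ν` satisfies the momentum equation `ṗ = (1+θ)|x|^θ sgn x`. -/
theorem escaping_force_eq {θ ν c₀ t : ℝ} (hθ0 : 0 < θ) (hθ1 : θ < 1) (hν : ν = 2 / (1 - θ))
    (hc₀ : c₀ = ((1 - θ) ^ 2 / 2) ^ (1 / (1 - θ))) (ht : 0 ≤ t) :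
    (1 + θ) * |c₀ * t ^ ν| ^ θ * Real.sign (c₀ * t ^ ν) =
      c₀ * ν * ((ν - 1) * t ^ (ν - 1 - 1)) := by
  have h1 : 0 < 1 - θ := by linarith
  have hb : 0 < (1 - θ) ^ 2 / 2 := by positivity
  have hc : 0 < c₀ := hc₀ ▸ Real.rpow_pos_of_pos hb _
  have hν0 : 0 < ν := hν ▸ by positivity
  have hexp : ν - 1 - 1 = ν * θ := by
    rw [hν]
    field_simp
    ring
  rcases ht.eq_or_lt with rfl | ht
  · rw [Real.zero_rpow hν0.ne', hexp, Real.zero_rpow (mul_pos hν0 hθ0).ne']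
    simp
  have hpos : 0 < c₀ * t ^ ν := mul_pos hc (Real.rpow_pos_of_pos ht _)
  have hcpow : c₀ = c₀ ^ θ * ((1 - θ) ^ 2 / 2) := by
    have h2 : c₀ ^ (1 - θ) = (1 - θ) ^ 2 / 2 := by
      rw [hc₀, ← Real.rpow_mul hb.le, one_div_mul_cancel h1.ne', Real.rpow_one]
    rw [← h2, ← Real.rpow_add hc, add_sub_cancel, Real.rpow_one]
  rw [Real.sign_of_pos hpos, abs_of_pos hpos, Real.mul_rpow hc.le (Real.rpow_nonneg ht.le _),
    ← Real.rpow_mul ht.le, hexp]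
  have hk : (1 - θ) ^ 2 / 2 * ν * (ν - 1) = 1 + θ := by
    rw [hν]
    field_simp
    ring
  calc _ = c₀ ^ θ * ((1 - θ) ^ 2 / 2 * ν * (ν - 1)) * t ^ (ν * θ) := by rw [hk]; ring
    _ = c₀ ^ θ * ((1 - θ) ^ 2 / 2) * ν * ((ν - 1) * t ^ (ν * θ)) := by ring
    _ = _ := by rw [← hcpow]

/- STATEMENT 12: the family of measures `μ_t = c₊ δ_{(X⁺(t),P⁺(t))} + c₋ δ_{(X⁻(t),P⁻(t))}`,
carried by the two explicit escaping trajectories of the Hamiltonian system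
`ẋ = p`, `ṗ = (1+θ)|x|^θ sgn x`, is a weak (distributional) solution of the Liouville
equation `∂_t μ + p ∂_x μ + (1+θ)|x|^θ sgn(x) ∂_p μ = 0`: for every compactly supported
smooth test function `φ`, `t ↦ ∫ φ dμ_t` is differentiable on `[0,∞)` with derivative
`∫ (p ∂_x φ + (1+θ)|x|^θ sgn(x) ∂_p φ) dμ_t`. -/
theorem liouville_weak_solution_two_deltas (θ : ℝ) (hθ0 : 0 < θ) (hθ1 : θ < 1)
    (ν c₀ : ℝ) (hν : ν = 2 / (1 - θ))
    (hc₀ : c₀ = ((1 - θ) ^ 2 / 2) ^ (1 / (1 - θ)))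
    (X P : ℝ → ℝ)
    (hX : ∀ t : ℝ, 0 ≤ t → X t = c₀ * t ^ ν)
    (hP : ∀ t : ℝ, 0 ≤ t → P t = c₀ * ν * t ^ (ν - 1))
    (cp cm : ℝ) (hcp : 0 ≤ cp) (hcm : 0 ≤ cm) (hsum : cp + cm = 1)
    (μ : ℝ → Measure (ℝ × ℝ))
    (hμ : ∀ t : ℝ, 0 ≤ t → μ t =
      ENNReal.ofReal cp • Measure.dirac (X t, P t) +
        ENNReal.ofReal cm • Measure.dirac (-X t, -P t)) :
    ∀ φ : ℝ × ℝ → ℝ, ContDiff ℝ (⊤ : ℕ∞) φ → HasCompactSupport φ →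
      ∀ t : ℝ, 0 ≤ t →
        HasDerivWithinAt (fun s => ∫ q, φ q ∂(μ s))
          (∫ q : ℝ × ℝ,
            (q.2 * fderiv ℝ φ q (1, 0) +
              (1 + θ) * |q.1| ^ θ * Real.sign q.1 * fderiv ℝ φ q (0, 1)) ∂(μ t))
          (Set.Ici 0) t := by
  intro φ hφ _ t ht
  have h1 : 0 < 1 - θ := by linarith
  have hν2 : 2 ≤ ν := by
    rw [hν, le_div_iff₀ h1]
    linarith
  have hdX : HasDerivWithinAt X (P t) (Set.Ici 0) t := by
    refine HasDerivWithinAt.congr_of_mem ?_ hX ht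
    rw [hP t ht, mul_assoc]
    exact ((Real.hasDerivAt_rpow_const (Or.inr (by linarith))).const_mul c₀).hasDerivWithinAt
  have hdP : HasDerivWithinAt P ((1 + θ) * |X t| ^ θ * Real.sign (X t)) (Set.Ici 0) t := by
    refine HasDerivWithinAt.congr_of_mem ?_ hP ht
    rw [hX t ht, escaping_force_eq hθ0 hθ1 hν hc₀ ht]
    exact ((Real.hasDerivAt_rpow_const (Or.inr (by linarith))).const_mul (c₀ * ν)).hasDerivWithinAt
  have hd : Differentiable ℝ φ := hφ.differentiable (by simp)
  have hplus := hasDerivWithinAt_comp_prodMk hd.differentiableAt hdX hdP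
  have hminus := hasDerivWithinAt_comp_prodMk (x := fun r => -X r) (p := fun r => -P r)
    hd.differentiableAt hdX.fun_neg hdP.fun_neg
  have hμint (f : ℝ × ℝ → ℝ) (s : ℝ) (hs : 0 ≤ s) :
      ∫ q, f q ∂(μ s) = cp * f (X s, P s) + cm * f (-X s, -P s) := by
    rw [hμ s hs, integral_two_diracs f _ _ hcp hcm]
  refine HasDerivWithinAt.congr_of_mem ?_ (fun s hs => hμint φ s hs) ht
  rw [hμint _ t ht]
  convert (hplus.const_mul cp).fun_add (hminus.const_mul cm) using 1
  simp only [abs_neg, Real.sign_neg, mul_neg]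
end
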